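/- Let M be a spacelike surface in ℝ^{3,1} with a canonical normal null direction Z such that a ≡ 0 and β ≡ 0 on M. Then the tangent part Z^⊤ is a constant vector Z₀^⊤ along M, and M can be parametrized as ψ(x,y) = α(y) + x Z₀^⊤, where α is a curve in ℝ^{3,1} with α'(y) orthogonal to Z₀^⊤ (with respect to the Minkowski form). -/

import Mathlib

noncomputable section

/-- Points of the parameter domain of the surface chart. -/
abbrev Pt : Type := ℝ × ℝ

/-- Vectors of the Minkowski space `ℝ^{3,1}`. -/
abbrev E4 : Type := Fin 4 → ℝ

/-- The Minkowski bilinear form of signature `(+,+,+,-)` on `ℝ⁴`. -/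
def mink (v w : E4) : ℝ := v 0 * w 0 + v 1 * w 1 + v 2 * w 2 - v 3 * w 3

/-- Realization in `ℝ^{3,1}` of a coordinate vector field `X` along the immersion `ψ`. -/
def vecF (ψ : Pt → E4) (X : Pt → Pt) : Pt → E4 := fun p => fderiv ℝ ψ p (X p)

/-- Flat (ambient) derivative of an `ℝ⁴`-valued field along a coordinate vector field. -/
def Dflat (X : Pt → Pt) (V : Pt → E4) : Pt → E4 := fun p => fderiv ℝ V p (X p)

/-- Second fundamental form `B(X,Y) = ∇̄_X Y − ∇_X Y`. -/
def sff (ψ : Pt → E4) (conn : (Pt → Pt) → (Pt → Pt) → Pt → Pt) (X Y : Pt → Pt) : Pt → E4 :=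
  fun p => Dflat X (vecF ψ Y) p - vecF ψ (conn X Y) p

/-- `v` is tangent to the surface at `p`. -/
def isTangentV (ψ : Pt → E4) (p : Pt) (v : E4) : Prop := ∃ w : Pt, fderiv ℝ ψ p w = v

/-- `v` is normal to the surface at `p`. -/
def isNormalV (ψ : Pt → E4) (p : Pt) (v : E4) : Prop := ∀ w : Pt, mink v (fderiv ℝ ψ p w) = 0

/-- Lie bracket of coordinate vector fields on the chart. -/
def lieB (X Y : Pt → Pt) : Pt → Pt := fun p => fderiv ℝ Y p (X p) - fderiv ℝ X p (Y p)

/-- Curvature tensor `R(X,Y)V = ∇_Y∇_X V − ∇_X∇_Y V + ∇_{[X,Y]}V`. -/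
def curvR (conn : (Pt → Pt) → (Pt → Pt) → Pt → Pt) (X Y V : Pt → Pt) : Pt → Pt :=
  fun p => conn Y (conn X V) p - conn X (conn Y V) p + conn (lieB X Y) V p

/-- Normal curvature tensor `R^⊥(X,Y)ν = ∇⊥_Y∇⊥_X ν − ∇⊥_X∇⊥_Y ν + ∇⊥_{[X,Y]}ν`. -/
def curvRperp (nconn : (Pt → Pt) → (Pt → E4) → Pt → E4) (X Y : Pt → Pt) (ν : Pt → E4) :
    Pt → E4 :=
  fun p => nconn Y (nconn X ν) p - nconn X (nconn Y ν) p + nconn (lieB X Y) ν p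

/-- Determinant of four vectors of `ℝ⁴` (the volume form `e₁∧e₂∧e₃∧e₄ ↦ 1`). -/
def det4 (a b c d : E4) : ℝ := Matrix.det (Matrix.of ![a, b, c, d])

/-- A spacelike surface in `ℝ^{3,1}`, given by a chart `ψ : U → ℝ^{3,1}`, endowed with a
canonical normal null direction with respect to the constant unit spacelike vector `Z`,
together with all the associated geometric data: the Levi-Civita connection `conn`,
the normal connection `nconn`, the tangent part `Z^⊤` (coordinates `ZT`), the oriented
orthonormal completion `W` (coordinates `Wc`), the shape operator `shA = A_{Z^⊥}`,
the 1-form `β` with `B(X,Z^⊤) = β(X)Z^⊥`, and the lightlike normal field `W'` with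
`⟨Z^⊥,W'⟩ = 1`.  Each piece of data is characterized by its defining property. -/
structure CNND where
  U : Set Pt
  hUopen : IsOpen U
  ψ : Pt → E4
  hψ : ContDiffOn ℝ (⊤ : ℕ∞) ψ U
  himm : ∀ p ∈ U, ∀ v : Pt, fderiv ℝ ψ p v = 0 → v = 0
  hspacelike : ∀ p ∈ U, ∀ v : Pt, v ≠ 0 → 0 < mink (fderiv ℝ ψ p v) (fderiv ℝ ψ p v)
  /-- Levi-Civita connection of the induced metric, as the tangent part of the flat one. -/
  conn : (Pt → Pt) → (Pt → Pt) → Pt → Pt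
  hconn : ∀ X Y, ∀ p ∈ U, DifferentiableAt ℝ (vecF ψ Y) p → isNormalV ψ p (sff ψ conn X Y p)
  hconnSmooth : ∀ X Y, ContDiffOn ℝ (⊤ : ℕ∞) X U → ContDiffOn ℝ (⊤ : ℕ∞) Y U → ContDiffOn ℝ (⊤ : ℕ∞) (conn X Y) U
  /-- Normal connection: the normal part of the flat derivative of a normal field. -/
  nconn : (Pt → Pt) → (Pt → E4) → Pt → E4
  hnconn : ∀ X ν, ∀ p ∈ U, (∀ q ∈ U, isNormalV ψ q (ν q)) → DifferentiableAt ℝ ν p →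
    isNormalV ψ p (nconn X ν p) ∧ isTangentV ψ p (Dflat X ν p - nconn X ν p)
  hnconnSmooth : ∀ X ν, ContDiffOn ℝ (⊤ : ℕ∞) X U → (∀ q ∈ U, isNormalV ψ q (ν q)) →
    ContDiffOn ℝ (⊤ : ℕ∞) ν U → ContDiffOn ℝ (⊤ : ℕ∞) (nconn X ν) U
  /-- The parallel (constant) vector field `Z`, a unit spacelike vector. -/
  Z : E4
  hZunit : mink Z Z = 1
  /-- Coordinates of the tangent part `Z^⊤` of `Z`; `Z^⊥ = Z − Z^⊤` is normal. -/
  ZT : Pt → Pt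
  hZTsmooth : ContDiffOn ℝ (⊤ : ℕ∞) ZT U
  hZTtangentpart : ∀ p ∈ U, isNormalV ψ p (Z - fderiv ℝ ψ p (ZT p))
  /-- canonical normal null direction: `Z^⊥` is lightlike … -/
  hZperpNull : ∀ p ∈ U, mink (Z - fderiv ℝ ψ p (ZT p)) (Z - fderiv ℝ ψ p (ZT p)) = 0
  /-- … and nowhere zero. -/
  hZperpNe : ∀ p ∈ U, Z - fderiv ℝ ψ p (ZT p) ≠ 0
  /-- Coordinates of the unit tangent field `W` orthogonal to `Z^⊤`, positively oriented. -/
  Wc : Pt → Pt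
  hWsmooth : ContDiffOn ℝ (⊤ : ℕ∞) Wc U
  hWunit : ∀ p ∈ U, mink (fderiv ℝ ψ p (Wc p)) (fderiv ℝ ψ p (Wc p)) = 1
  hWorth : ∀ p ∈ U, mink (fderiv ℝ ψ p (ZT p)) (fderiv ℝ ψ p (Wc p)) = 0
  hWorient : ∀ p ∈ U, 0 < (ZT p).1 * (Wc p).2 - (ZT p).2 * (Wc p).1
  /-- The shape operator `A_{Z^⊥}`: `⟨A_{Z^⊥}X, Y⟩ = ⟨B(X,Y), Z^⊥⟩`. -/
  shA : (Pt → Pt) → Pt → Pt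
  hshA : ∀ X Y, ∀ p ∈ U, DifferentiableAt ℝ (vecF ψ Y) p →
    mink (fderiv ℝ ψ p (shA X p)) (fderiv ℝ ψ p (Y p)) =
      mink (sff ψ conn X Y p) (Z - fderiv ℝ ψ p (ZT p))
  /-- The 1-form `β` with `B(X, Z^⊤) = β(X) Z^⊥`. -/
  beta : Pt → Pt → ℝ
  hbeta : ∀ X, ∀ p ∈ U, sff ψ conn X ZT p = beta p (X p) • (Z - fderiv ℝ ψ p (ZT p))
  /-- The lightlike normal field `W'` with `⟨Z^⊥, W'⟩ = 1`, such that
  `(Z^⊤, W, (Z^⊥+W')/√2, (Z^⊥−W')/√2)` is a positively oriented orthonormal frame. -/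
  Wp : Pt → E4
  hWpNormal : ∀ p ∈ U, isNormalV ψ p (Wp p)
  hWpNull : ∀ p ∈ U, mink (Wp p) (Wp p) = 0
  hWpPair : ∀ p ∈ U, mink (Z - fderiv ℝ ψ p (ZT p)) (Wp p) = 1
  hWpOrient : ∀ p ∈ U, 0 < det4 (fderiv ℝ ψ p (ZT p)) (fderiv ℝ ψ p (Wc p))
    ((Real.sqrt 2)⁻¹ • ((Z - fderiv ℝ ψ p (ZT p)) + Wp p))
    ((Real.sqrt 2)⁻¹ • ((Z - fderiv ℝ ψ p (ZT p)) - Wp p))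

namespace CNND

variable (S : CNND)

/-- The normal part `Z^⊥` of `Z` along the surface. -/
def Zperp : Pt → E4 := fun p => S.Z - fderiv ℝ S.ψ p (S.ZT p)

/-- The second fundamental form of the surface. -/
def B : (Pt → Pt) → (Pt → Pt) → Pt → E4 := sff S.ψ S.conn

/-- The function `a = α(W) = ⟨B(W,W), Z^⊥⟩`. -/
def afun : Pt → ℝ := fun p => mink (S.B S.Wc S.Wc p) (S.Zperp p)

/-- The 1-form `α(X) = ⟨B(X,W), Z^⊥⟩`. -/
def alphaF (X : Pt → Pt) : Pt → ℝ := fun p => mink (S.B X S.Wc p) (S.Zperp p)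

/-- The mean curvature vector `H⃗ = (1/2)(B(Z^⊤,Z^⊤) + B(W,W))`. -/
def Hvec : Pt → E4 := fun p => (1 / 2 : ℝ) • (S.B S.ZT S.ZT p + S.B S.Wc S.Wc p)

/-- The Gauss curvature `K = ⟨R(Z^⊤,W)Z^⊤, W⟩`. -/
def Kfun : Pt → ℝ := fun p =>
  mink (fderiv ℝ S.ψ p (curvR S.conn S.ZT S.Wc S.ZT p)) (fderiv ℝ S.ψ p (S.Wc p))

/-- The normal curvature `K_N = ⟨R^⊥(Z^⊤,W)Z^⊥, W'⟩`. -/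
def KNfun : Pt → ℝ := fun p => mink (curvRperp S.nconn S.ZT S.Wc S.Zperp p) (S.Wp p)

end CNND

/-- The wedge `v ∧ w` of two vectors of `ℝ⁴`, as an antisymmetric matrix (bivector). -/
def wedge2 (v w : E4) : Fin 4 → Fin 4 → ℝ := fun i j => v i * w j - v j * w i

/-- The Gauss map `G = Z^⊤ ∧ W : M → Λ²ℝ^{3,1}`. -/
def CNND.Gmap (S : CNND) : Pt → Fin 4 → Fin 4 → ℝ :=
  fun p => wedge2 (fderiv ℝ S.ψ p (S.ZT p)) (fderiv ℝ S.ψ p (S.Wc p))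

/-- The signs of the Minkowski metric. -/
def epsM : Fin 4 → ℝ := fun i => if i = 3 then -1 else 1

/-- The induced (signature `(3,3)`) inner product on bivectors of `ℝ^{3,1}`:
`⟨v∧w, v'∧w'⟩ = ⟨v,v'⟩⟨w,w'⟩ − ⟨v,w'⟩⟨w,v'⟩`. -/
def binner (η η' : Fin 4 → Fin 4 → ℝ) : ℝ :=
  (1 / 2) * ∑ i : Fin 4, ∑ j : Fin 4, epsM i * epsM j * η i j * η' i j

/-- The wedge product `Λ²ℝ^{3,1} × Λ²ℝ^{3,1} → Λ⁴ℝ^{3,1} ≅ ℝ`, normalized so that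
`(v∧w)∧(v'∧w') = det(v,w,v',w')`. -/
def bwedge (η η' : Fin 4 → Fin 4 → ℝ) : ℝ :=
  (1 / 4) * ∑ σ : Equiv.Perm (Fin 4),
    ((Equiv.Perm.sign σ : ℤ) : ℝ) * η (σ 0) (σ 1) * η' (σ 2) (σ 3)

/-- The `ℂ`-bilinear form `H(η,η') = ⟨η,η'⟩ + i η∧η'` on bivectors, where `i = −⋆`. -/
def HformC (η η' : Fin 4 → Fin 4 → ℝ) : ℂ :=
  (binner η η' : ℝ) + (bwedge η η' : ℝ) * Complex.I

/-- The quadratic form `δ(u) = dG(u) ∧ dG(u)` whose zero directions are the asymptotic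
directions. -/
def CNND.deltaQ (S : CNND) (p : Pt) (u : Pt) : ℝ :=
  bwedge (fderiv ℝ S.Gmap p u) (fderiv ℝ S.Gmap p u)

/-- `g` is a differentiable curve in `U` which rests at `a` until time `0` and at `b` from
time `1` on. -/
structure IsTransit {E : Type*} [NormedAddCommGroup E] [NormedSpace ℝ E]
    (U : Set E) (a b : E) (g : ℝ → E) : Prop where
  differentiable : Differentiable ℝ g
  mem : ∀ t, g t ∈ U
  eq_left : ∀ t ≤ 0, g t = a
  eq_right : ∀ t, 1 ≤ t → g t = b

namespace IsTransit

variable {E : Type*} [NormedAddCommGroup E] [NormedSpace ℝ E] {U : Set E} {a b c : E}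
  {g h : ℝ → E}

lemma trans (hg : IsTransit U a b g) (hh : IsTransit U b c h) :
    ∃ k, IsTransit U a c k ∧ Set.range g ⊆ Set.range k ∧ Set.range h ⊆ Set.range k := by
  set k : ℝ → E := fun t => g (2 * t) + h (2 * t - 1) - b with hk
  have hk1 : ∀ t, 2 * t ≤ 1 → k t = g (2 * t) := fun t ht => by
    simp [hk, hh.eq_left (2 * t - 1) (by linarith)]
  have hk2 : ∀ t, 1 ≤ 2 * t → k t = h (2 * t - 1) := fun t ht => by
    simp [hk, hg.eq_right (2 * t) ht]
  refine ⟨k, ⟨?_, fun t => ?_, fun t ht => ?_, fun t ht => ?_⟩, ?_, ?_⟩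
  · exact ((hg.differentiable.comp (by fun_prop)).add
      (hh.differentiable.comp (by fun_prop))).sub_const b
  · rcases le_total (2 * t) 1 with ht | ht
    · rw [hk1 t ht]; exact hg.mem _
    · rw [hk2 t ht]; exact hh.mem _
  · rw [hk1 t (by linarith), hg.eq_left _ (by linarith)]
  · rw [hk2 t (by linarith), hh.eq_right _ (by linarith)]
  · rintro _ ⟨t, rfl⟩
    refine ⟨min t 1 / 2, ?_⟩
    rw [hk1 _ (by linarith [min_le_right t 1]), mul_div_cancel₀ _ two_ne_zero]
    rcases le_total t 1 with ht | ht
    · rw [min_eq_left ht]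
    · rw [min_eq_right ht, hg.eq_right 1 le_rfl, hg.eq_right t ht]
  · rintro _ ⟨t, rfl⟩
    refine ⟨(max t 0 + 1) / 2, ?_⟩
    rw [hk2 _ (by linarith [le_max_right t 0]), mul_div_cancel₀ _ two_ne_zero, add_sub_cancel_right]
    rcases le_total t 0 with ht | ht
    · rw [max_eq_right ht, hh.eq_left 0 le_rfl, hh.eq_left t ht]
    · rw [max_eq_left ht]

lemma exists_of_segment_subset (h : segment ℝ a b ⊆ U) : ∃ g, IsTransit U a b g := by
  refine ⟨fun t => AffineMap.lineMap a b t.smoothTransition, ?_, fun t => h ?_, fun t ht => ?_,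
    fun t ht => ?_⟩
  · have h1 : Differentiable ℝ Real.smoothTransition :=
      (Real.smoothTransition.contDiff (n := 1)).differentiable (by simp)
    simp only [AffineMap.lineMap_apply_module]
    fun_prop
  · rw [segment_eq_image_lineMap]
    exact ⟨_, ⟨Real.smoothTransition.nonneg t, Real.smoothTransition.le_one t⟩, rfl⟩
  · simp [Real.smoothTransition.zero_of_nonpos ht]
  · simp [Real.smoothTransition.one_of_one_le ht]

lemma exists_of_isPreconnected (hU : IsOpen U) (hU' : IsPreconnected U) (ha : a ∈ U)
    (hb : b ∈ U) : ∃ g, IsTransit U a b g := by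
  refine hU'.induction₂' (fun x y => ∃ g, IsTransit U x y g) (fun x hx => ?_)
    (fun x y z _ _ _ => ?_) ha hb
  · obtain ⟨ε, hε, hball⟩ := Metric.isOpen_iff.1 hU x hx
    filter_upwards [mem_nhdsWithin_of_mem_nhds (Metric.ball_mem_nhds x hε)] with y hy
    have hseg : segment ℝ x y ⊆ U :=
      ((convex_ball x ε).segment_subset (Metric.mem_ball_self hε) hy).trans hball
    exact ⟨exists_of_segment_subset hseg, exists_of_segment_subset (segment_symm ℝ x y ▸ hseg)⟩
  · rintro ⟨g, hg⟩ ⟨h, hh⟩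
    obtain ⟨k, hk, -⟩ := hg.trans hh
    exact ⟨k, hk⟩

/-- Countably many loops at the same point can be traversed by a single differentiable curve. -/
lemma exists_differentiable_of_loops {g : ℕ → ℝ → E} (hg : ∀ n, IsTransit U a a (g n)) :
    ∃ c : ℝ → E, Differentiable ℝ c ∧ (∀ t, c t ∈ U) ∧ ∀ n, Set.range (g n) ⊆ Set.range c := by
  set G : ℤ → ℝ → E := fun n => g n.toNat with hG
  have hGt : ∀ n, IsTransit U a a (G n) := fun n => hg _
  set c : ℝ → E := fun t => G ⌊t⌋ (t - ⌊t⌋) with hc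
  have hcn : ∀ (n : ℤ) (t : ℝ), n ≤ t → t ≤ n + 1 → c t = G n (t - n) := by
    intro n t h1 h2
    rcases h2.lt_or_eq with h2 | rfl
    · simp only [hc, Int.floor_eq_iff.2 ⟨h1, h2⟩]
    · have : ⌊(n : ℝ) + 1⌋ = n + 1 := by simp
      simp only [hc, this]
      rw [(hGt _).eq_left _ (by simp), (hGt _).eq_right _ (by simp)]
  refine ⟨c, fun t₀ => ?_, fun t => (hGt _).mem _, fun n => ?_⟩
  · set n := ⌊t₀⌋
    have hd : Differentiable ℝ (fun t : ℝ => G (n - 1) (t - n + 1) + G n (t - n) - a) :=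
      (((hGt _).differentiable.comp (by fun_prop)).add
        ((hGt _).differentiable.comp (by fun_prop))).sub_const a
    refine (hd t₀).congr_of_eventuallyEq ?_
    have h1 : (n : ℝ) - 1 < t₀ := by linarith [Int.floor_le t₀]
    have h2 : t₀ < n + 1 := Int.lt_floor_add_one t₀
    filter_upwards [Ioo_mem_nhds h1 h2] with t ht
    rcases le_total (n : ℝ) t with h | h
    · rw [hcn n t h ht.2.le, (hGt (n - 1)).eq_right _ (by linarith)]
      simp
    · rw [hcn (n - 1) t (by push_cast; exact ht.1.le) (by push_cast; linarith),
        (hGt n).eq_left _ (by linarith)]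
      push_cast
      simp [sub_add]
  · rintro _ ⟨t, rfl⟩
    refine ⟨n + max 0 (min t 1), ?_⟩
    have hGn : G n = g n := by simp [hG]
    rw [hcn n _ (by simp) (by simp)]
    simp only [hGn, Int.cast_natCast, add_sub_cancel_left]
    rcases le_total t 0 with h0 | h0
    · rw [(hg n).eq_left t h0, (hg n).eq_left _ (by simp [h0])]
    · rcases le_total t 1 with h1 | h1
      · rw [min_eq_left h1, max_eq_right h0]
      · rw [(hg n).eq_right t h1, (hg n).eq_right _ (by simp [h1])]

end IsTransit

/-- If every point of a connected open set `U` has a neighbourhood whose image under `f` is covered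
by a curve, then the image of `U` is covered by a single curve. -/
lemma exists_differentiable_curve_image_subset {E F : Type*} [NormedAddCommGroup E]
    [NormedSpace ℝ E] [SecondCountableTopology E] {U : Set E} (hU : IsOpen U)
    (hU' : IsConnected U) (f : E → F)
    (hf : ∀ q ∈ U, ∃ N ∈ nhds q, ∃ a b g, IsTransit U a b g ∧ f '' N ⊆ f '' Set.range g) :
    ∃ c : ℝ → E, Differentiable ℝ c ∧ (∀ t, c t ∈ U) ∧ f '' U ⊆ f '' Set.range c := by
  obtain ⟨x₀, hx₀⟩ := hU'.nonempty
  have hloop : ∀ q : E, ∃ N, ∃ g, IsTransit U x₀ x₀ g ∧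
      (q ∈ U → N ∈ nhds q ∧ f '' N ⊆ f '' Set.range g) := by
    intro q
    by_cases hq : q ∈ U
    · obtain ⟨N, hN, a, b, g, hg, hfg⟩ := hf q hq
      have ha : a ∈ U := hg.eq_left 0 le_rfl ▸ hg.mem 0
      have hb : b ∈ U := hg.eq_right 1 le_rfl ▸ hg.mem 1
      obtain ⟨u, hu⟩ := IsTransit.exists_of_isPreconnected hU hU'.isPreconnected hx₀ ha
      obtain ⟨v, hv⟩ := IsTransit.exists_of_isPreconnected hU hU'.isPreconnected hb hx₀
      obtain ⟨k, hk, -, hgk⟩ := hu.trans hg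
      obtain ⟨l, hl, hkl, -⟩ := hk.trans hv
      exact ⟨N, l, hl, fun _ => ⟨hN, hfg.trans (Set.image_mono (hgk.trans hkl))⟩⟩
    · exact ⟨∅, fun _ => x₀, ⟨by fun_prop, fun _ => hx₀, fun _ _ => rfl, fun _ _ => rfl⟩,
        fun h => absurd h hq⟩
  choose N g hg hN using hloop
  obtain ⟨s, hsU, hsc, hs⟩ := TopologicalSpace.countable_cover_nhdsWithin (f := N) (s := U)
    (fun x hx => mem_nhdsWithin_of_mem_nhds (hN x hx).1)
  have hsne : s.Nonempty := by
    obtain ⟨x, hx, -⟩ := Set.mem_iUnion₂.1 (hs hx₀)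
    exact ⟨x, hx⟩
  obtain ⟨e, he⟩ := hsc.exists_eq_range hsne
  obtain ⟨c, hc, hcU, hcg⟩ := IsTransit.exists_differentiable_of_loops (g := fun n => g (e n))
    (fun n => hg _)
  refine ⟨c, hc, hcU, ?_⟩
  rintro _ ⟨p, hp, rfl⟩
  obtain ⟨x, hx, hpx⟩ := Set.mem_iUnion₂.1 (hs hp)
  obtain ⟨n, rfl⟩ := he ▸ hx
  exact Set.image_mono (hcg n) ((hN _ (hsU hx)).2 ⟨p, hpx, rfl⟩)

/-- A map whose derivative vanishes along a vector field `X` is locally determined by its values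
on a curve, provided that `X` is straightened by a map `Φ` which is a local diffeomorphism. -/
lemma exists_transit_of_straightening {F : Type*} [NormedAddCommGroup F] [NormedSpace ℝ F]
    {U : Set Pt} (hU : IsOpen U) {Φ X : Pt → Pt} {f : Pt → F} (hΦ : ContDiffOn ℝ 1 Φ U)
    (hf : DifferentiableOn ℝ f U) (hΦX : ∀ p ∈ U, fderiv ℝ Φ p (X p) = (1, 0))
    (hfX : ∀ p ∈ U, fderiv ℝ f p (X p) = 0) {q : Pt} (hq : q ∈ U)
    (hinj : Function.Injective (fderiv ℝ Φ q)) :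
    ∃ N ∈ nhds q, ∃ a b g, IsTransit U a b g ∧ f '' N ⊆ f '' Set.range g := by
  have hΦq : ContDiffAt ℝ 1 Φ q := hΦ.contDiffAt (hU.mem_nhds hq)
  let A : Pt ≃L[ℝ] Pt :=
    (LinearEquiv.ofInjectiveEndo (fderiv ℝ Φ q : Pt →ₗ[ℝ] Pt) hinj).toContinuousLinearEquiv
  have hA : HasFDerivAt Φ (A : Pt →L[ℝ] Pt) q := by
    have h1 : (A : Pt →L[ℝ] Pt) = fderiv ℝ Φ q := by ext <;> rfl
    rw [h1]
    exact (hΦq.differentiableAt (by simp)).hasFDerivAt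
  have hstrict := hΦq.hasStrictFDerivAt' hA (by simp)
  set G := hstrict.localInverse Φ A q
  have hGsmooth : ContDiffAt ℝ 1 G (Φ q) := hΦq.to_localInverse hA (by simp)
  have hGq : G (Φ q) = q := hstrict.localInverse_apply_image
  have hGU : ∀ᶠ z in nhds (Φ q), G z ∈ U :=
    hGsmooth.continuousAt.eventually (by rw [hGq]; exact hU.mem_nhds hq)
  have hGd : ∀ᶠ z in nhds (Φ q), DifferentiableAt ℝ G z :=
    (hGsmooth.eventually (by simp)).mono fun z hz => hz.differentiableAt (by simp)
  obtain ⟨ε, hε, hball⟩ := Metric.eventually_nhds_iff_ball.1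
    (hGU.and (hGd.and hstrict.eventually_right_inverse.eventually_nhds))
  have hfG : ∀ z ∈ Metric.ball (Φ q) ε, DifferentiableAt ℝ (f ∘ G) z ∧
      fderiv ℝ (f ∘ G) z (1, 0) = 0 := by
    intro z hz
    obtain ⟨hzU, hzd, hzr⟩ := hball z hz
    have hΦz : DifferentiableAt ℝ Φ (G z) :=
      (hΦ.contDiffAt (hU.mem_nhds hzU)).differentiableAt (by simp)
    have hfz : DifferentiableAt ℝ f (G z) := hf.differentiableAt (hU.mem_nhds hzU)
    have hcomp : (fderiv ℝ Φ (G z)).comp (fderiv ℝ G z) = ContinuousLinearMap.id ℝ Pt := by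
      rw [← fderiv_comp z hΦz hzd]
      exact (Filter.EventuallyEq.fderiv_eq (f := id) hzr).trans fderiv_id
    have hcomp' : ∀ v, fderiv ℝ Φ (G z) (fderiv ℝ G z v) = v := fun v =>
      congrArg (fun L : Pt →L[ℝ] Pt => L v) hcomp
    have hinj' : Function.Injective (fderiv ℝ Φ (G z) : Pt →ₗ[ℝ] Pt) :=
      LinearMap.injective_iff_surjective.2 fun v => ⟨_, hcomp' v⟩
    have hX : fderiv ℝ G z (1, 0) = X (G z) :=
      hinj' ((hcomp' _).trans (hΦX _ hzU).symm)
    refine ⟨hfz.comp z hzd, ?_⟩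
    rw [fderiv_comp z hfz hzd, ContinuousLinearMap.comp_apply, hX, hfX _ hzU]
  have hconst : ∀ s t, (s, t) ∈ Metric.ball (Φ q) ε →
      f (G (s, t)) = f (G ((Φ q).1, t)) := by
    intro s t hst
    rw [← ball_prod_same] at hst hfG
    refine Metric.isOpen_ball.is_const_of_deriv_eq_zero (𝕜 := ℝ)
      (f := fun s => f (G (s, t))) (convex_ball (Φ q).1 ε).isPreconnected ?_ ?_ hst.1
      (Metric.mem_ball_self hε)
    · intro r hr
      have h2 : DifferentiableAt ℝ (fun r : ℝ => (r, t)) r := by fun_prop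
      exact ((hfG (r, t) ⟨hr, hst.2⟩).1.comp r h2).differentiableWithinAt
    · intro r hr
      have h2 : HasDerivAt (fun r : ℝ => (r, t)) (1, 0) r :=
        (hasDerivAt_id r).prodMk (hasDerivAt_const r t)
      have h3 := (hfG (r, t) ⟨hr, hst.2⟩).1.hasFDerivAt.comp_hasDerivAt r h2
      rw [(hfG (r, t) ⟨hr, hst.2⟩).2] at h3
      exact h3.deriv
  set σ : ℝ → Pt := fun t =>
    ((Φ q).1, (Φ q).2 + ε / 2 * (2 * t.smoothTransition - 1)) with hσ
  have hσd : Differentiable ℝ σ := by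
    have h1 : Differentiable ℝ Real.smoothTransition :=
      (Real.smoothTransition.contDiff (n := 1)).differentiable (by simp)
    fun_prop
  have hσb : ∀ t, σ t ∈ Metric.ball (Φ q) ε := by
    intro t
    rw [← ball_prod_same]
    refine ⟨Metric.mem_ball_self hε, ?_⟩
    have h0 := Real.smoothTransition.nonneg t
    have h1 := Real.smoothTransition.le_one t
    simp only [hσ, Metric.mem_ball, Real.dist_eq, add_sub_cancel_left, abs_lt]
    constructor <;> nlinarith
  refine ⟨Φ ⁻¹' Metric.ball (Φ q) (ε / 2) ∩ {p | G (Φ p) = p}, Filter.inter_mem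
    (hΦq.continuousAt (Metric.ball_mem_nhds _ (half_pos hε))) hstrict.eventually_left_inverse,
    G (σ 0), G (σ 1), G ∘ σ, ⟨fun t => (hball _ (hσb t)).2.1.comp t (hσd t),
    fun t => (hball _ (hσb t)).1, fun t ht => ?_, fun t ht => ?_⟩, ?_⟩
  · simp [hσ, Real.smoothTransition.zero_of_nonpos ht]
  · simp [hσ, Real.smoothTransition.one_of_one_le ht]
  · rintro _ ⟨p, ⟨hp, hGp⟩, rfl⟩
    have hp' : Φ p ∈ Metric.ball (Φ q) ε := Metric.ball_subset_ball (by linarith) hp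
    rw [Set.mem_preimage, ← ball_prod_same] at hp
    have h2 := hp.2
    rw [Metric.mem_ball, Real.dist_eq, abs_lt] at h2
    have hy : ((Φ p).2 - (Φ q).2) / ε + 1 / 2 ∈
        Set.Icc (Real.smoothTransition 0) (Real.smoothTransition 1) := by
      rw [Real.smoothTransition.zero, Real.smoothTransition.one]
      constructor
      · have : -(1 / 2) ≤ ((Φ p).2 - (Φ q).2) / ε := by rw [le_div_iff₀ hε]; linarith
        linarith
      · have : ((Φ p).2 - (Φ q).2) / ε ≤ 1 / 2 := by rw [div_le_iff₀ hε]; linarith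
        linarith
    obtain ⟨t, -, ht⟩ := intermediate_value_Icc zero_le_one
      Real.smoothTransition.continuous.continuousOn hy
    have hσt : σ t = ((Φ q).1, (Φ p).2) := by
      simp only [hσ, ht]
      congr 1
      field_simp
      ring
    refine ⟨G (σ t), ⟨t, rfl⟩, ?_⟩
    rw [hσt, ← hconst (Φ p).1 (Φ p).2 hp', Prod.mk.eta, hGp]

/-- The Minkowski form as a continuous bilinear map. -/
def minkL : E4 →L[ℝ] E4 →L[ℝ] ℝ :=
  (LinearMap.mk₂ ℝ mink (fun _ _ _ => by simp [mink]; ring) (fun _ _ _ => by simp [mink]; ring)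
    (fun _ _ _ => by simp [mink]; ring)
    (fun _ _ _ => by simp [mink]; ring)).toContinuousBilinearMap

lemma minkL_apply (v w : E4) : minkL v w = mink v w := rfl

lemma mink_comm (v w : E4) : mink v w = mink w v := by
  simp only [mink]; ring

lemma mink_add_left (u v w : E4) : mink (u + v) w = mink u w + mink v w := by
  simp only [← minkL_apply, map_add, add_apply]

lemma mink_sub_left (u v w : E4) : mink (u - v) w = mink u w - mink v w := by
  simp only [← minkL_apply, map_sub, sub_apply]

lemma mink_smul_left (r : ℝ) (v w : E4) : mink (r • v) w = r * mink v w := by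
  simp only [← minkL_apply, map_smul, smul_apply, smul_eq_mul]

lemma mink_zero_left (w : E4) : mink 0 w = 0 := by simp [mink]

lemma fderiv_mink_apply {E : Type*} [NormedAddCommGroup E] [NormedSpace ℝ E] {f g : E → E4}
    {x : E} (hf : DifferentiableAt ℝ f x) (hg : DifferentiableAt ℝ g x) (v : E) :
    fderiv ℝ (fun y => mink (f y) (g y)) x v =
      mink (f x) (fderiv ℝ g x v) + mink (fderiv ℝ f x v) (g x) := by
  have h := minkL.hasFDerivAt_of_bilinear hf.hasFDerivAt hg.hasFDerivAt
  simp only [minkL_apply] at h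
  rw [h.fderiv]
  simp [minkL_apply]

namespace CNND

variable (S : CNND) {p : Pt}

/-- The tangent part `Z^⊤` as a vector field along the surface. -/
def Ztan : Pt → E4 := vecF S.ψ S.ZT

lemma contDiffAt_ψ (hp : p ∈ S.U) : ContDiffAt ℝ (⊤ : ℕ∞) S.ψ p :=
  S.hψ.contDiffAt (S.hUopen.mem_nhds hp)

lemma contDiffAt_fderiv_ψ (hp : p ∈ S.U) : ContDiffAt ℝ (⊤ : ℕ∞) (fderiv ℝ S.ψ) p :=
  (S.contDiffAt_ψ hp).fderiv_right (by simp)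

lemma differentiableAt_ψ (hp : p ∈ S.U) : DifferentiableAt ℝ S.ψ p :=
  (S.contDiffAt_ψ hp).differentiableAt (by simp)

lemma differentiableAt_fderiv_ψ (hp : p ∈ S.U) : DifferentiableAt ℝ (fderiv ℝ S.ψ) p :=
  (S.contDiffAt_fderiv_ψ hp).differentiableAt (by simp)

lemma differentiableAt_ZT (hp : p ∈ S.U) : DifferentiableAt ℝ S.ZT p :=
  (S.hZTsmooth.contDiffAt (S.hUopen.mem_nhds hp)).differentiableAt (by simp)

lemma differentiableAt_Wc (hp : p ∈ S.U) : DifferentiableAt ℝ S.Wc p :=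
  (S.hWsmooth.contDiffAt (S.hUopen.mem_nhds hp)).differentiableAt (by simp)

lemma fderiv_vecF (hp : p ∈ S.U) {X : Pt → Pt} (hX : DifferentiableAt ℝ X p) (v : Pt) :
    fderiv ℝ (vecF S.ψ X) p v =
      fderiv ℝ S.ψ p (fderiv ℝ X p v) + fderiv ℝ (fderiv ℝ S.ψ) p v (X p) := by
  have h := ((S.differentiableAt_fderiv_ψ hp).hasFDerivAt.clm_apply hX.hasFDerivAt).fderiv
  change fderiv ℝ (fun y => fderiv ℝ S.ψ y (X y)) p v = _
  rw [h]
  simp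

lemma differentiableAt_vecF (hp : p ∈ S.U) {X : Pt → Pt} (hX : DifferentiableAt ℝ X p) :
    DifferentiableAt ℝ (vecF S.ψ X) p :=
  (S.differentiableAt_fderiv_ψ hp).clm_apply hX

lemma mink_Ztan_Ztan (hp : p ∈ S.U) : mink (S.Ztan p) (S.Ztan p) = 1 := by
  have h1 := S.hZperpNull p hp
  have h2 := S.hZTtangentpart p hp (S.ZT p)
  have h3 := S.hZunit
  simp only [Ztan, vecF]
  rw [mink_sub_left] at h1 h2
  rw [mink_comm S.Z, mink_sub_left, mink_comm (fderiv ℝ S.ψ p (S.ZT p)) (S.Z - _),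
    mink_sub_left, mink_comm (fderiv ℝ S.ψ p (S.ZT p)) S.Z] at h1
  linarith

/-- The fields `Z^⊤` and `W` span the tangent plane. -/
lemma exists_coords (hp : p ∈ S.U) (u : Pt) : ∃ r s : ℝ, u = r • S.ZT p + s • S.Wc p := by
  have h := S.hWorient p hp
  set d := (S.ZT p).1 * (S.Wc p).2 - (S.ZT p).2 * (S.Wc p).1 with hd
  refine ⟨(u.1 * (S.Wc p).2 - u.2 * (S.Wc p).1) / d,
    ((S.ZT p).1 * u.2 - (S.ZT p).2 * u.1) / d, ?_⟩
  ext <;> simp only [Prod.fst_add, Prod.snd_add, Prod.smul_fst, Prod.smul_snd, smul_eq_mul] <;>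
    field_simp <;> rw [hd] <;> ring

/-- A tangent vector orthogonal to both `Z^⊤` and `W` vanishes. -/
lemma fderiv_ψ_eq_zero (hp : p ∈ S.U) {u : Pt}
    (h1 : mink (fderiv ℝ S.ψ p u) (fderiv ℝ S.ψ p (S.ZT p)) = 0)
    (h2 : mink (fderiv ℝ S.ψ p u) (fderiv ℝ S.ψ p (S.Wc p)) = 0) : fderiv ℝ S.ψ p u = 0 := by
  by_contra hne
  have hu : u ≠ 0 := fun h => hne (by simp [h])
  obtain ⟨r, s, hrs⟩ := S.exists_coords hp u
  have h3 := S.hspacelike p hp u hu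
  have h4 : mink (fderiv ℝ S.ψ p u) (fderiv ℝ S.ψ p u) = 0 := by
    nth_rewrite 1 [hrs]
    rw [map_add, map_smul, map_smul, mink_add_left, mink_smul_left, mink_smul_left,
      mink_comm _ (fderiv ℝ S.ψ p u), mink_comm _ (fderiv ℝ S.ψ p u), h1, h2]
    simp
  exact h3.ne' h4

/-- If `β ≡ 0`, the derivative of `Z^⊤` is tangent to the surface. -/
lemma exists_fderiv_Ztan_eq (hb : ∀ p ∈ S.U, ∀ v : Pt, S.beta p v = 0) (hp : p ∈ S.U) (v : Pt) :
    ∃ u, fderiv ℝ S.Ztan p v = fderiv ℝ S.ψ p u := by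
  have h := S.hbeta (fun _ => v) p hp
  rw [hb p hp, zero_smul] at h
  exact ⟨_, sub_eq_zero.1 h⟩

lemma mink_fderiv_Ztan_Ztan (hp : p ∈ S.U) (v : Pt) :
    mink (fderiv ℝ S.Ztan p v) (S.Ztan p) = 0 := by
  have hd : DifferentiableAt ℝ S.Ztan p := S.differentiableAt_vecF hp (S.differentiableAt_ZT hp)
  have h1 := fderiv_mink_apply hd hd v
  have h2 : (fun y => mink (S.Ztan y) (S.Ztan y)) =ᶠ[nhds p] fun _ => 1 := by
    filter_upwards [S.hUopen.mem_nhds hp] with y hy using S.mink_Ztan_Ztan hy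
  rw [h2.fderiv_eq, mink_comm] at h1
  simp at h1
  linarith

/-- Differentiating `⟨Z^⊥, W⟩ = 0`. -/
lemma mink_fderiv_Ztan_W (hp : p ∈ S.U) (v : Pt) :
    mink (fderiv ℝ S.Ztan p v) (fderiv ℝ S.ψ p (S.Wc p)) =
      mink (S.Zperp p) (fderiv ℝ (vecF S.ψ S.Wc) p v) := by
  have hd : DifferentiableAt ℝ S.Ztan p := S.differentiableAt_vecF hp (S.differentiableAt_ZT hp)
  have hw := S.differentiableAt_vecF hp (S.differentiableAt_Wc hp)
  have h1 := fderiv_mink_apply (hd.const_sub S.Z) hw v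
  have h2 : (fun y => mink (S.Z - S.Ztan y) (vecF S.ψ S.Wc y)) =ᶠ[nhds p] fun _ => 0 := by
    filter_upwards [S.hUopen.mem_nhds hp] with y hy using S.hZTtangentpart y hy (S.Wc y)
  rw [h2.fderiv_eq, fderiv_const_sub, neg_apply,
    ← zero_sub (fderiv ℝ S.Ztan p v), mink_sub_left, mink_sub_left, mink_zero_left] at h1
  simp only [fderiv_fun_const, Pi.zero_apply, zero_apply] at h1
  change _ = mink (S.Z - S.Ztan p) _
  rw [mink_sub_left]
  simp only [vecF] at h1 ⊢
  linarith

/-- If `a ≡ 0` and `β ≡ 0`, then `Z^⊤` is parallel. -/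
lemma fderiv_Ztan_eq_zero (ha : ∀ p ∈ S.U, S.afun p = 0)
    (hb : ∀ p ∈ S.U, ∀ v : Pt, S.beta p v = 0) (hp : p ∈ S.U) : fderiv ℝ S.Ztan p = 0 := by
  have hnormal : ∀ u, mink (S.Zperp p) (fderiv ℝ S.ψ p u) = 0 := S.hZTtangentpart p hp
  have hadd : ∀ x y z : E4, mink x (y + z) = mink x y + mink x z := fun x y z => by
    rw [mink_comm, mink_add_left, mink_comm y, mink_comm z]
  have hWZ : mink (S.Zperp p) (fderiv ℝ (vecF S.ψ S.Wc) p (S.ZT p)) = 0 := by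
    obtain ⟨u, hu⟩ := S.exists_fderiv_Ztan_eq hb hp (S.Wc p)
    have h1 := hnormal u
    rw [← hu, Ztan, S.fderiv_vecF hp (S.differentiableAt_ZT hp), hadd, hnormal, zero_add] at h1
    have hsmooth : minSmoothness ℝ 2 ≤ ((⊤ : ℕ∞) : WithTop ℕ∞) := by
      rw [minSmoothness_of_isRCLikeNormedField]
      exact WithTop.coe_le_coe.2 (le_top : (2 : ℕ∞) ≤ ⊤)
    rw [S.fderiv_vecF hp (S.differentiableAt_Wc hp), hadd, hnormal, zero_add,
      ((S.contDiffAt_ψ hp).isSymmSndFDerivAt hsmooth).eq, h1]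
  have hWW : mink (S.Zperp p) (fderiv ℝ (vecF S.ψ S.Wc) p (S.Wc p)) = 0 := by
    have h1 := ha p hp
    rw [afun, B, sff, Dflat, mink_sub_left, mink_comm, vecF, mink_comm _ (S.Zperp p),
      hnormal, sub_zero] at h1
    exact h1
  refine ContinuousLinearMap.ext fun v => ?_
  rw [zero_apply]
  obtain ⟨u, hu⟩ := S.exists_fderiv_Ztan_eq hb hp v
  rw [hu]
  refine S.fderiv_ψ_eq_zero hp ?_ ?_
  · rw [← hu]
    exact S.mink_fderiv_Ztan_Ztan hp v
  · rw [← hu, S.mink_fderiv_Ztan_W hp]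
    obtain ⟨r, s, rfl⟩ := S.exists_coords hp v
    rw [map_add, map_smul, map_smul, hadd, mink_comm, mink_smul_left, mink_comm,
      mink_comm _ (s • _), mink_smul_left, mink_comm _ (S.Zperp p), hWZ, hWW]
    simp

/-- The projection of the surface along a constant `Z^⊤` is locally covered by curves. -/
lemma exists_transit_of_Ztan_eq {Z₀ : E4} (hZ₀ : ∀ p ∈ S.U, fderiv ℝ S.ψ p (S.ZT p) = Z₀)
    {q : Pt} (hq : q ∈ S.U) :
    ∃ N ∈ nhds q, ∃ a b g, IsTransit S.U a b g ∧
      (fun p => S.ψ p - mink (S.ψ p) Z₀ • Z₀) '' N ⊆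
        (fun p => S.ψ p - mink (S.ψ p) Z₀ • Z₀) '' Set.range g := by
  have hZZ : mink Z₀ Z₀ = 1 := hZ₀ q hq ▸ S.mink_Ztan_Ztan hq
  set w := fderiv ℝ S.ψ q (S.Wc q)
  have hZw : mink Z₀ w = 0 := hZ₀ q hq ▸ S.hWorth q hq
  have hd : ∀ p ∈ S.U, ∀ z, HasFDerivAt (fun p => mink (S.ψ p) z)
      ((minkL.flip z).comp (fderiv ℝ S.ψ p)) p := fun p hp z =>
    (minkL.flip z).hasFDerivAt.comp p (S.differentiableAt_ψ hp).hasFDerivAt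
  have hc : ∀ z, ContDiffOn ℝ 1 (fun p => mink (S.ψ p) z) S.U := fun z =>
    (minkL.flip z).contDiff.comp_contDiffOn (S.hψ.of_le (by exact_mod_cast le_top))
  have hΦ : ∀ p ∈ S.U, ∀ u, fderiv ℝ (fun p => (mink (S.ψ p) Z₀, mink (S.ψ p) w)) p u =
      (mink (fderiv ℝ S.ψ p u) Z₀, mink (fderiv ℝ S.ψ p u) w) := fun p hp u => by
    rw [((hd p hp Z₀).prodMk (hd p hp w)).fderiv]
    rfl
  have hf : ∀ p ∈ S.U, HasFDerivAt (fun p => S.ψ p - mink (S.ψ p) Z₀ • Z₀)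
      (fderiv ℝ S.ψ p - ((minkL.flip Z₀).comp (fderiv ℝ S.ψ p)).smulRight Z₀) p :=
    fun p hp => (S.differentiableAt_ψ hp).hasFDerivAt.sub ((hd p hp Z₀).smul_const Z₀)
  refine exists_transit_of_straightening S.hUopen (X := S.ZT)
    (Φ := fun p => (mink (S.ψ p) Z₀, mink (S.ψ p) w)) ((hc Z₀).prodMk (hc w))
    (fun p hp => (hf p hp).differentiableAt.differentiableWithinAt) (fun p hp => ?_)
    (fun p hp => ?_) hq ?_
  · rw [hΦ p hp, hZ₀ p hp, hZZ, hZw]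
  · rw [(hf p hp).fderiv]
    simp [hZ₀ p hp, minkL_apply, hZZ]
  · rw [injective_iff_map_eq_zero]
    intro u hu
    rw [hΦ q hq, Prod.mk_eq_zero] at hu
    refine S.himm q hq u (S.fderiv_ψ_eq_zero hq ?_ hu.2)
    rw [hZ₀ q hq]
    exact hu.1

end CNND

/-- If `a ≡ 0` and `β ≡ 0` on `M`, then the tangent part `Z^⊤` is a constant
vector `Z₀^⊤` along `M`, and `M` can be parametrized as `ψ(x,y) = α(y) + x Z₀^⊤`, where `α`
is a curve in `ℝ^{3,1}` with `α'(y)` orthogonal to `Z₀^⊤`. -/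
theorem cnnd_ruled_parametrization (S : CNND) (hUconn : IsConnected S.U)
    (ha : ∀ p ∈ S.U, S.afun p = 0) (hb : ∀ p ∈ S.U, ∀ v : Pt, S.beta p v = 0) :
    ∃ Z₀ : E4, (∀ p ∈ S.U, fderiv ℝ S.ψ p (S.ZT p) = Z₀) ∧
      ∃ (γ : ℝ → E4) (V : Set Pt), Differentiable ℝ γ ∧
        (∀ y : ℝ, mink (deriv γ y) Z₀ = 0) ∧
        (fun q : Pt => γ q.2 + q.1 • Z₀) '' V = S.ψ '' S.U := by
  have hconst : ∃ Z₀, ∀ p ∈ S.U, fderiv ℝ S.ψ p (S.ZT p) = Z₀ :=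
    S.hUopen.exists_is_const_of_fderiv_eq_zero hUconn.isPreconnected
      (fun p hp => (S.differentiableAt_vecF hp
        (S.differentiableAt_ZT hp)).differentiableWithinAt)
      (fun p hp => S.fderiv_Ztan_eq_zero ha hb hp)
  obtain ⟨Z₀, hZ₀⟩ := hconst
  have hZZ : mink Z₀ Z₀ = 1 := by
    obtain ⟨q, hq⟩ := hUconn.nonempty
    exact hZ₀ q hq ▸ S.mink_Ztan_Ztan hq
  obtain ⟨c, hc, hcU, hcov⟩ := exists_differentiable_curve_image_subset S.hUopen hUconn _
    (fun q hq => S.exists_transit_of_Ztan_eq hZ₀ hq)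
  set γ : ℝ → E4 := fun t => S.ψ (c t) - mink (S.ψ (c t)) Z₀ • Z₀ with hγ
  have hψc : Differentiable ℝ fun t => S.ψ (c t) := fun t =>
    (S.differentiableAt_ψ (hcU t)).comp t (hc t)
  have hγd : Differentiable ℝ γ :=
    hψc.sub (((minkL.flip Z₀).differentiable.comp hψc).smul_const Z₀)
  have hγZ : ∀ t, mink (γ t) Z₀ = 0 := fun t => by
    rw [hγ, mink_sub_left, mink_smul_left, hZZ, mul_one, sub_self]
  refine ⟨Z₀, hZ₀, γ, (fun q : Pt => γ q.2 + q.1 • Z₀) ⁻¹' (S.ψ '' S.U), hγd, fun y => ?_, ?_⟩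
  · have h1 := fderiv_mink_apply (hγd y) (differentiableAt_const Z₀) 1
    simp only [hγZ, fderiv_fun_const, Pi.zero_apply, zero_apply,
      mink_comm _ 0, mink_zero_left, zero_add] at h1
    exact h1.symm
  · refine Set.image_preimage_eq_of_subset ?_
    rintro _ ⟨p, hp, rfl⟩
    obtain ⟨_, ⟨t, rfl⟩, ht⟩ := hcov ⟨p, hp, rfl⟩
    refine ⟨(mink (S.ψ p) Z₀, t), ?_⟩
    change γ t + mink (S.ψ p) Z₀ • Z₀ = S.ψ p
    rw [hγ]
    exact eq_sub_iff_add_eq.1 ht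

end
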